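/- Let n, d ≥ 1 be integers and let A be a complex matrix indexed by (Fin n → Fin d) such that P(π)·A = A·P(π) for every permutation π of Fin n. Then A lies in the complex linear span of the set { U^{⊗n} : U ∈ SU(d) }, where SU(d) is the group of d×d complex unitary matrices of determinant 1. -/

import Mathlib

/-- The `n`-fold tensor power of a `d × d` complex matrix, as a matrix indexed by
functions `Fin n → Fin d`: `(U^{⊗n})_{x,y} = ∏ i, U_{x i, y i}`. -/
def tensorPow (n d : ℕ) (U : Matrix (Fin d) (Fin d) ℂ) :
    Matrix (Fin n → Fin d) (Fin n → Fin d) ℂ :=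
  fun x y => ∏ i, U (x i) (y i)

/-- The permutation operator `P(π)` on `n` qudits: `(P(π))_{x,y} = 1` if `x ∘ π = y`,
and `0` otherwise. -/
def permOp (n d : ℕ) (π : Equiv.Perm (Fin n)) :
    Matrix (Fin n → Fin d) (Fin n → Fin d) ℂ :=
  fun x y => if x ∘ π = y then 1 else 0

theorem swAux_smul (n d : ℕ) (c : ℂ) (M : Matrix (Fin d) (Fin d) ℂ) :
    tensorPow n d (c • M) = c ^ n • tensorPow n d M := by
  ext x y
  simp [tensorPow, Finset.prod_mul_distrib]

/-- Evaluating a functional on a tensor power, in coordinates. -/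
theorem swAux_expand (n d : ℕ) (φ : Module.Dual ℂ (Matrix (Fin n → Fin d) (Fin n → Fin d) ℂ))
    (B : Matrix (Fin n → Fin d) (Fin n → Fin d) ℂ) :
    φ B = ∑ x, ∑ y, φ (Matrix.single x y 1) * B x y := by
  conv_lhs => rw [Matrix.matrix_eq_sum_single B]
  simp only [map_sum]
  refine Finset.sum_congr rfl fun x _ => Finset.sum_congr rfl fun y _ => ?_
  have : Matrix.single x y (B x y) = B x y • Matrix.single x y (1 : ℂ) := by
    rw [Matrix.smul_single]; simp
  rw [this, map_smul, smul_eq_mul, mul_comm]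

/-- Vanishing on special unitaries gives vanishing on scaled unitaries. -/
theorem swAux_scaled (n d : ℕ) (hd : 1 ≤ d)
    (φ : Module.Dual ℂ (Matrix (Fin n → Fin d) (Fin n → Fin d) ℂ))
    (h : ∀ U : Matrix (Fin d) (Fin d) ℂ, U ∈ Matrix.unitaryGroup (Fin d) ℂ → U.det = 1 →
      φ (tensorPow n d U) = 0)
    (N : Matrix (Fin d) (Fin d) ℂ) (r : ℝ) (hr : 0 < r)
    (hN : star N * N = (r : ℂ) • (1 : Matrix (Fin d) (Fin d) ℂ)) :
    φ (tensorPow n d N) = 0 := by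
  obtain ⟨z, hz⟩ := IsAlgClosed.exists_pow_nat_eq N.det (n := d) (by omega)
  have h1 : star N.det * N.det = (r : ℂ) ^ d := by
    have := congrArg Matrix.det hN
    rw [Matrix.det_mul, Matrix.star_eq_conjTranspose, Matrix.det_conjTranspose,
      Matrix.det_smul] at this
    simpa using this
  have h2 : star z * z = (r : ℂ) := by
    have e : star z * z = ((Complex.normSq z : ℝ) : ℂ) := by
      rw [Complex.normSq_eq_conj_mul_self]; rfl
    rw [← hz, star_pow, ← mul_pow, e] at h1
    rw [e]
    have h3 : (Complex.normSq z) ^ d = r ^ d := by exact_mod_cast h1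
    have := (pow_left_inj₀ (Complex.normSq_nonneg z) hr.le (by omega)).1 h3
    rw [this]
  have hz0 : z ≠ 0 := by
    rintro rfl
    simp at h2
    exact hr.ne (by exact_mod_cast h2)
  have key := h (z⁻¹ • N) ?_ ?_
  · rw [swAux_smul, map_smul, smul_eq_mul] at key
    rcases mul_eq_zero.1 key with h | h
    · exact absurd h (pow_ne_zero _ (inv_ne_zero hz0))
    · exact h
  · rw [Matrix.mem_unitaryGroup_iff', star_smul, smul_mul_smul_comm, hN, smul_smul, ← h2,
      star_inv₀]
    have : (star z) ≠ 0 := star_ne_zero.2 hz0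
    have e : (star z)⁻¹ * z⁻¹ * (star z * z) = 1 := by field_simp
    rw [e, one_smul]
  · rw [Matrix.det_smul, ← hz]
    simp [hz0]

open scoped ComplexOrder in
/-- Cayley transform of a skew-Hermitian matrix. -/
theorem swAux_skew (n d : ℕ) (hd : 1 ≤ d)
    (φ : Module.Dual ℂ (Matrix (Fin n → Fin d) (Fin n → Fin d) ℂ))
    (h : ∀ U : Matrix (Fin d) (Fin d) ℂ, U ∈ Matrix.unitaryGroup (Fin d) ℂ → U.det = 1 →
      φ (tensorPow n d U) = 0)
    (W : Matrix (Fin d) (Fin d) ℂ) (hW : star W = -W) :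
    φ (tensorPow n d ((1 + W) * (1 - W).adjugate)) = 0 := by
  have hs : star (1 - W) = 1 + W := by rw [star_sub, star_one, hW]; abel
  have hs' : star (1 + W) = 1 - W := by rw [star_add, star_one, hW]; abel
  have hdet : (1 + W).det = star (1 - W).det := by
    rw [← Matrix.det_conjTranspose, ← Matrix.star_eq_conjTranspose, hs]
  have hpd : ((1 : Matrix (Fin d) (Fin d) ℂ) + star W * W).PosDef :=
    Matrix.PosDef.one.add_posSemidef (Matrix.posSemidef_conjTranspose_mul_self W)
  have hprod : (1 + W) * (1 - W) = 1 + star W * W := by rw [hW]; noncomm_ring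
  have hne : (1 - W).det ≠ 0 := by
    intro h0
    have := hpd.det_pos.ne'
    rw [← hprod, Matrix.det_mul, h0, mul_zero] at this
    exact this rfl
  refine swAux_scaled n d hd φ h _ (Complex.normSq (1 - W).det) (Complex.normSq_pos.2 hne) ?_
  have hcomm : (1 - W) * (1 + W) = (1 + W) * (1 - W) := by noncomm_ring
  rw [star_mul, hs', Matrix.star_eq_conjTranspose, Matrix.adjugate_conjTranspose,
    ← Matrix.star_eq_conjTranspose, hs, mul_assoc, ← mul_assoc (1 - W), hcomm, mul_assoc (1 + W),
    Matrix.mul_adjugate, Matrix.mul_smul, Matrix.mul_smul, mul_one, Matrix.adjugate_mul, smul_smul,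
    hdet, Complex.normSq_eq_conj_mul_self, mul_comm]
  rfl

/-- Cayley transform of an arbitrary matrix, by complexification. -/
theorem swAux_all (n d : ℕ) (hd : 1 ≤ d)
    (φ : Module.Dual ℂ (Matrix (Fin n → Fin d) (Fin n → Fin d) ℂ))
    (h : ∀ U : Matrix (Fin d) (Fin d) ℂ, U ∈ Matrix.unitaryGroup (Fin d) ℂ → U.det = 1 →
      φ (tensorPow n d U) = 0)
    (W : Matrix (Fin d) (Fin d) ℂ) :
    φ (tensorPow n d ((1 + W) * (1 - W).adjugate)) = 0 := by
  obtain ⟨P, Q, hP, hQ, hPQ⟩ : ∃ P Q : Matrix (Fin d) (Fin d) ℂ, star P = -P ∧ star Q = -Q ∧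
      W = P + Complex.I • Q := by
    refine ⟨(1 / 2 : ℂ) • (W - star W), (-Complex.I / 2) • (W + star W), ?_, ?_, ?_⟩
    · ext i j; simp [Matrix.star_apply]; ring
    · ext i j; simp [Matrix.star_apply]; ring
    · ext i j; simp [Matrix.star_apply]; ring_nf; simp; ring
  let L : Matrix (Fin d) (Fin d) (Polynomial ℂ) :=
    P.map Polynomial.C + (Polynomial.X : Polynomial ℂ) • Q.map Polynomial.C
  let N := (1 + L) * (1 - L).adjugate
  let p : Polynomial ℂ := ∑ x, ∑ y, Polynomial.C (φ (Matrix.single x y 1)) *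
    ∏ i : Fin n, N (x i) (y i)
  have hL : ∀ t : ℂ, (Polynomial.evalRingHom t).mapMatrix L = P + t • Q := by
    intro t
    ext i j
    simp [L]
    ring
  have hN : ∀ t : ℂ, (Polynomial.evalRingHom t).mapMatrix N =
      (1 + (P + t • Q)) * (1 - (P + t • Q)).adjugate := by
    intro t
    simp only [N]
    rw [map_mul, RingHom.map_adjugate, map_add, map_sub, map_one, hL]
  have hp : ∀ t : ℂ, p.eval t =
      φ (tensorPow n d ((1 + (P + t • Q)) * (1 - (P + t • Q)).adjugate)) := by
    intro t
    rw [← hN, swAux_expand]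
    simp [p, Polynomial.eval_finsetSum, Polynomial.eval_prod, tensorPow]
  have hp0 : p = 0 := by
    apply Polynomial.eq_zero_of_infinite_isRoot
    refine Set.Infinite.mono (s := Set.range (fun t : ℝ => (t : ℂ))) ?_
      (Set.infinite_range_of_injective Complex.ofReal_injective)
    rintro _ ⟨t, rfl⟩
    show p.eval (t : ℂ) = 0
    rw [hp]
    apply swAux_skew n d hd φ h
    rw [star_add, star_smul (t : ℂ) Q, hP, hQ]
    simp
    abel
  rw [hPQ, ← hp, hp0, Polynomial.eval_zero]

/-- Vanishing on special unitaries gives vanishing on all matrices. -/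
theorem swAux_dense (n d : ℕ) (hd : 1 ≤ d)
    (φ : Module.Dual ℂ (Matrix (Fin n → Fin d) (Fin n → Fin d) ℂ))
    (h : ∀ U : Matrix (Fin d) (Fin d) ℂ, U ∈ Matrix.unitaryGroup (Fin d) ℂ → U.det = 1 →
      φ (tensorPow n d U) = 0)
    (M : Matrix (Fin d) (Fin d) ℂ) :
    φ (tensorPow n d M) = 0 := by
  obtain ⟨s, hs0, hs⟩ : ∃ s : ℂ, s ≠ 0 ∧ (s • (1 : Matrix (Fin d) (Fin d) ℂ) + M).det ≠ 0 := by
    have hne : (-M).charpoly * Polynomial.X ≠ 0 :=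
      mul_ne_zero (Matrix.charpoly_monic _).ne_zero Polynomial.X_ne_zero
    by_contra! hcon
    apply hne
    apply Polynomial.funext
    intro s
    rw [Polynomial.eval_mul, Matrix.eval_charpoly, Polynomial.eval_X, Polynomial.eval_zero]
    by_cases h0 : s = 0
    · simp [h0]
    · have := hcon s h0
      rw [sub_neg_eq_add, Matrix.scalar_apply, ← Matrix.smul_one_eq_diagonal, this, zero_mul]
  set T := s • (1 : Matrix (Fin d) (Fin d) ℂ) + M with hT
  have hTu : IsUnit T.det := isUnit_iff_ne_zero.2 hs
  have hTT : T * T⁻¹ = 1 := Matrix.mul_nonsing_inv _ hTu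
  have hM : M = T - s • 1 := by rw [hT]; abel
  let W := 1 - (2 * s) • T⁻¹
  have h1 : 1 - W = (2 * s) • T⁻¹ := by simp [W]
  have h2 : s • (1 + W) = M * (1 - W) := by
    rw [h1, hM, Matrix.mul_smul, sub_mul, hTT]
    ext i j
    simp [W]
    ring
  have h3 : (1 - W).det ≠ 0 := by
    rw [h1, Matrix.det_smul]
    refine mul_ne_zero (pow_ne_zero _ (mul_ne_zero two_ne_zero hs0)) ?_
    intro h0
    have := congrArg Matrix.det hTT
    rw [Matrix.det_mul, h0] at this
    simp at this
  have h4 : (1 - W).det • M = s • ((1 + W) * (1 - W).adjugate) := by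
    rw [← Matrix.smul_mul, h2, mul_assoc, Matrix.mul_adjugate, Matrix.mul_smul, mul_one]
  have h5 := congrArg (fun B => φ (tensorPow n d B)) h4
  simp only [swAux_smul, map_smul, swAux_all n d hd φ h W, smul_zero, smul_eq_mul, mul_zero] at h5
  exact (mul_eq_zero.1 h5).resolve_left (pow_ne_zero _ h3)

theorem swAux_perm {n : ℕ} {γ : Type*} [DecidableEq γ] (z w : Fin n → γ)
    (h : ∑ i, Finsupp.single (z i) 1 = (∑ i, Finsupp.single (w i) 1 : γ →₀ ℕ)) :
    ∃ π : Equiv.Perm (Fin n), ∀ i, w (π i) = z i := by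
  have hc : ∀ c, Fintype.card {i // z i = c} = Fintype.card {i // w i = c} := by
    intro c
    have := DFunLike.congr_fun h c
    simpa [Finsupp.finsetSum_apply, Finsupp.single_apply, Fintype.card_subtype] using this
  exact ⟨Equiv.ofFiberEquiv fun c => Fintype.equivOfCardEq (hc c),
    fun i => Equiv.ofFiberEquiv_map _ i⟩

theorem swAux_inv (n d : ℕ) (A : Matrix (Fin n → Fin d) (Fin n → Fin d) ℂ)
    (hA : ∀ π : Equiv.Perm (Fin n), permOp n d π * A = A * permOp n d π)
    (π : Equiv.Perm (Fin n)) (x y : Fin n → Fin d) : A (x ∘ π) (y ∘ π) = A x y := by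
  have := congrFun (congrFun (hA π) x) (y ∘ π)
  have e : ∀ w : Fin n → Fin d, w ∘ π = y ∘ π ↔ w = y := fun w =>
    ⟨fun h => π.surjective.injective_comp_right h, fun h => by rw [h]⟩
  simpa [Matrix.mul_apply, permOp, e] using this

theorem swAux_symm (n d : ℕ) (A : Matrix (Fin n → Fin d) (Fin n → Fin d) ℂ)
    (hA : ∀ π : Equiv.Perm (Fin n), permOp n d π * A = A * permOp n d π)
    (φ : Module.Dual ℂ (Matrix (Fin n → Fin d) (Fin n → Fin d) ℂ))
    (h : ∀ M : Matrix (Fin d) (Fin d) ℂ, φ (tensorPow n d M) = 0) : φ A = 0 := by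
  classical
  let m : (Fin n → Fin d) × (Fin n → Fin d) → (Fin d × Fin d →₀ ℕ) :=
    fun q => ∑ i, Finsupp.single (q.1 i, q.2 i) 1
  let a : (Fin n → Fin d) × (Fin n → Fin d) → ℂ := fun q => φ (Matrix.single q.1 q.2 1)
  have hex : ∀ B : Matrix (Fin n → Fin d) (Fin n → Fin d) ℂ, φ B = ∑ q, a q * B q.1 q.2 := by
    intro B
    rw [swAux_expand, Fintype.sum_prod_type]
  let p : MvPolynomial (Fin d × Fin d) ℂ := ∑ q, MvPolynomial.monomial (m q) (a q)
  have hp : p = 0 := by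
    apply MvPolynomial.funext
    intro v
    rw [map_zero, ← h (fun i j => v (i, j)), hex]
    simp only [p, map_sum]
    refine Finset.sum_congr rfl fun q _ => ?_
    have : MvPolynomial.monomial (m q) (a q) =
        MvPolynomial.C (a q) * ∏ i, MvPolynomial.X (q.1 i, q.2 i) := by
      simp only [m, MvPolynomial.X]
      rw [← MvPolynomial.monomial_sum_one, MvPolynomial.C_mul_monomial, mul_one]
    rw [this]
    simp [tensorPow, map_prod]
  have hcoef : ∀ k, ∑ q with m q = k, a q = 0 := by
    intro k
    have := congrArg (MvPolynomial.coeff k) hp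
    simpa [p, MvPolynomial.coeff_sum, MvPolynomial.coeff_monomial, Finset.sum_filter] using this
  have hAm : ∀ q q', m q = m q' → A q.1 q.2 = A q'.1 q'.2 := by
    intro q q' hq
    obtain ⟨π, hπ⟩ := swAux_perm (fun i => (q.1 i, q.2 i)) (fun i => (q'.1 i, q'.2 i)) hq
    rw [← swAux_inv n d A hA π q'.1 q'.2]
    congr 1
    · congr 1
      funext i; exact (congrArg Prod.fst (hπ i)).symm
    · funext i; exact (congrArg Prod.snd (hπ i)).symm
  rw [hex, ← Finset.sum_fiberwise_of_maps_to (s := Finset.univ) (t := Finset.univ.image m) (g := m)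
    (fun q _ => Finset.mem_image_of_mem _ (Finset.mem_univ q))]
  refine Finset.sum_eq_zero fun k hk => ?_
  obtain ⟨q0, -, rfl⟩ := Finset.mem_image.1 hk
  rw [← zero_mul (A q0.1 q0.2), ← hcoef (m q0), Finset.sum_mul]
  refine Finset.sum_congr rfl fun q hq => ?_
  rw [hAm q q0 (Finset.mem_filter.1 hq).2]

/-- **Schur–Weyl duality (span form).** Any matrix `A` on `n` qudits that commutes with
all permutation operators lies in the complex linear span of the tensor powers
`U^{⊗n}` for `U ∈ SU(d)`. -/
theorem perm_invariant_mem_span_tensorPow_SU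
    (n d : ℕ) (hn : 1 ≤ n) (hd : 1 ≤ d)
    (A : Matrix (Fin n → Fin d) (Fin n → Fin d) ℂ)
    (hA : ∀ π : Equiv.Perm (Fin n), permOp n d π * A = A * permOp n d π) :
    A ∈ Submodule.span ℂ
      {B : Matrix (Fin n → Fin d) (Fin n → Fin d) ℂ |
        ∃ U : Matrix (Fin d) (Fin d) ℂ,
          U ∈ Matrix.unitaryGroup (Fin d) ℂ ∧ U.det = 1 ∧ B = tensorPow n d U} := by
  by_contra hmem
  obtain ⟨φ, hφA, hφ⟩ := Submodule.exists_le_ker_of_notMem hmem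
  refine hφA (swAux_symm n d A hA φ (swAux_dense n d hd φ fun U hU hdet => ?_))
  exact hφ (Submodule.subset_span ⟨U, hU, hdet, rfl⟩)
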